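/- arXiv:math/9201255 — 4 statements merged into one kernel-verified Lean document; each statement's English description precedes it below -/
import Mathlib

section
/- For 0 ≤ k ≤ m−1, the map j : Λ^k V* → Λ^{k+1} V* ⊗ V, j(φ) = φ ∧ I, is injective. -/
open scoped TensorProduct

noncomputable section

variable {V : Type} [AddCommGroup V] [Module ℝ V]

/-- The identity of `V`, viewed as a `V`-valued alternating 1-form. -/
def idOneForm : AlternatingMap ℝ V V (Fin 1) :=
  { MultilinearMap.ofSubsingleton ℝ V V (0 : Fin 1) LinearMap.id with
    map_eq_zero_of_eq' := fun _ i j _ hij => absurd (Subsingleton.elim i j) hij }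

/-- `φ ∧ I` : the wedge of a scalar `k`-form with the identity, a `V`-valued `(k+1)`-form.
It is given by the usual determinant-convention wedge product, here realized as the
alternatization of `φ ⊗ Id` divided by `k! · 1!`. -/
def wedgeI {k : ℕ} (φ : AlternatingMap ℝ V ℝ (Fin k)) : AlternatingMap ℝ V V (Fin (k + 1)) :=
  ((k.factorial : ℝ))⁻¹ •
    MultilinearMap.alternatization
      (MultilinearMap.domDomCongr finSumFinEquiv
        ((TensorProduct.lid ℝ V).toLinearMap.compMultilinearMap
          (φ.toMultilinearMap.domCoprod idOneForm.toMultilinearMap)))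

/-- Currying a `V`-valued `(n+1)`-form in its first argument, as an alternating `n`-form with
values in the endomorphisms of `V`. -/
def curryFst {n : ℕ} (L : AlternatingMap ℝ V V (Fin (n + 1))) :
    AlternatingMap ℝ V (V →ₗ[ℝ] V) (Fin n) where
  toFun w :=
    { toFun := fun x => L (Fin.cons x w)
      map_add' := fun a b => by
        simpa [Fin.update_cons_zero] using L.map_update_add (Fin.cons a w) 0 a b
      map_smul' := fun c a => by
        simpa [Fin.update_cons_zero] using L.map_update_smul (Fin.cons a w) 0 c a }
  map_update_add' w i a b := by
    rename_i iDE
    obtain rfl : iDE = instDecidableEqFin n := Subsingleton.elim _ _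
    ext x
    show L (Fin.cons x (Function.update w i (a + b))) =
      L (Fin.cons x (Function.update w i a)) + L (Fin.cons x (Function.update w i b))
    have hcu : ∀ y : V, (Fin.cons (α := fun _ : Fin (n + 1) => V) x (Function.update w i y)) =
        Function.update (Fin.cons x w) i.succ y := fun y =>
      Fin.cons_update (α := fun _ : Fin (n + 1) => V) x w i y
    rw [hcu, hcu, hcu]
    exact L.map_update_add _ i.succ a b
  map_update_smul' w i c a := by
    rename_i iDE
    obtain rfl : iDE = instDecidableEqFin n := Subsingleton.elim _ _
    ext x
    show L (Fin.cons x (Function.update w i (c • a))) = c • L (Fin.cons x (Function.update w i a))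
    have hcu : ∀ y : V, (Fin.cons (α := fun _ : Fin (n + 1) => V) x (Function.update w i y)) =
        Function.update (Fin.cons x w) i.succ y := fun y =>
      Fin.cons_update (α := fun _ : Fin (n + 1) => V) x w i y
    rw [hcu, hcu]
    exact L.map_update_smul _ i.succ c a
  map_eq_zero_of_eq' w i j hw hij := by
    ext x
    show L (Fin.cons x w) = (0 : V →ₗ[ℝ] V) x
    rw [LinearMap.zero_apply]
    exact L.map_eq_zero_of_eq _ (i := i.succ) (j := j.succ)
      (by simpa using hw) (by simpa [Fin.succ_inj] using hij)

/-- The contraction (trace) `c : Λ^{n+1} V* ⊗ V → Λ^n V*`,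
`(cK)(v₂,…,v_{n+1}) = tr (v ↦ K (v, v₂, …, v_{n+1}))`. -/
def contr {n : ℕ} (K : AlternatingMap ℝ V V (Fin (n + 1))) : AlternatingMap ℝ V ℝ (Fin n) :=
  (LinearMap.trace ℝ V).compAlternatingMap (curryFst K)

/-- The contraction as a linear map. -/
def contrL (n : ℕ) :
    AlternatingMap ℝ V V (Fin (n + 1)) →ₗ[ℝ] AlternatingMap ℝ V ℝ (Fin n) where
  toFun := contr
  map_add' K K' := by
    ext w
    have : curryFst (K + K') w = curryFst K w + curryFst K' w := by
      ext x; simp [curryFst]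
    simp [contr, this]
  map_smul' c K := by
    ext w
    have : curryFst (c • K) w = c • curryFst K w := by
      ext x; simp [curryFst]
    simp [contr, this]



theorem wedge_aux {k : ℕ} (φ : AlternatingMap ℝ V ℝ (Fin k)) (v : Fin k → V) (x : V)
    (f : V →ₗ[ℝ] ℝ) (hx : f x = 1) (hv : ∀ i, f (v i) = 0) :
    f (wedgeI φ (Fin.snoc (α := fun _ => V) v x)) =
      ((k.factorial : ℝ))⁻¹ *
        ((Finset.univ.filter (fun σ : Equiv.Perm (Fin (k+1)) => σ (Fin.last k) = Fin.last k)).card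
          * φ v) := by
  classical
  have key : ∀ σ : Equiv.Perm (Fin (k+1)),
      f (Equiv.Perm.sign σ • (φ (fun i => (Fin.snoc (α := fun _ => V) v x : Fin (k+1) → V) (σ i.castSucc)) •
        (Fin.snoc (α := fun _ => V) v x : Fin (k+1) → V) (σ (Fin.last k)))) =
      if σ (Fin.last k) = Fin.last k then φ v else 0 := by
    intro σ
    split_ifs with h
    · have hne : ∀ y, σ y ≠ Fin.last k ↔ y ≠ Fin.last k := by
        intro y
        rw [not_iff_not]
        constructor
        · intro hy; exact σ.injective (hy.trans h.symm)
        · rintro rfl; exact h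
      let e := finSuccAboveEquiv (Fin.last k)
      let τ : Equiv.Perm (Fin k) := e.symm.permCongr (σ.subtypePerm hne)
      have hs : Equiv.Perm.sign τ = Equiv.Perm.sign σ := by
        simp only [τ, Equiv.Perm.sign_permCongr]
        exact Equiv.Perm.sign_subtypePerm _ _ (fun y hy => by rintro rfl; exact hy h)
      have ht : ∀ i, σ i.castSucc = (τ i).castSucc := by
        intro i
        have h1 : e (τ i) = σ.subtypePerm hne (e i) := by simp [τ, Equiv.permCongr_apply]
        have h2 := congrArg Subtype.val h1
        simpa [e, finSuccAboveEquiv_apply] using h2.symm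
      have h3 := φ.map_perm v τ
      rw [h]
      simp only [ht, Fin.snoc_castSucc, Fin.snoc_last]
      have h4 : (fun i => v (τ i)) = v ∘ τ := rfl
      rw [h4, h3, hs]
      rcases Int.units_eq_one_or (Equiv.Perm.sign σ) with h5 | h5 <;> simp [h5, hx]
    · obtain ⟨j, hj⟩ := Fin.exists_castSucc_eq.mpr h
      rw [← hj]
      rcases Int.units_eq_one_or (Equiv.Perm.sign σ) with h5 | h5 <;> simp [h5, hv]
  unfold wedgeI
  rw [AlternatingMap.smul_apply, MultilinearMap.alternatization_apply, map_smul, map_sum, smul_eq_mul]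
  congr 1
  rw [← nsmul_eq_mul, ← Finset.sum_const, Finset.sum_filter]
  refine Finset.sum_congr rfl fun σ _ => ?_
  rw [← key σ]
  congr 1

/-- For `0 ≤ k ≤ m - 1`, the map `j : Λ^k V* → Λ^{k+1} V* ⊗ V`, `j φ = φ ∧ I`,
is injective. -/
theorem wedgeI_injective [FiniteDimensional ℝ V] (m : ℕ) (hm : Module.finrank ℝ V = m)
    (k : ℕ) (hk : k + 1 ≤ m) :
    Function.Injective (wedgeI : AlternatingMap ℝ V ℝ (Fin k) → AlternatingMap ℝ V V (Fin (k + 1))) := by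
  intro φ ψ h
  ext v
  by_cases hv : LinearIndependent ℝ v
  · have hlt : Submodule.span ℝ (Set.range v) ≠ ⊤ := by
      intro ht
      have h1 := finrank_span_eq_card hv
      rw [ht, finrank_top, Fintype.card_fin] at h1
      omega
    obtain ⟨x, hx⟩ : ∃ x, x ∉ Submodule.span ℝ (Set.range v) := by
      by_contra! hc
      exact hlt (Submodule.eq_top_iff'.mpr hc)
    obtain ⟨g, hg, hg'⟩ := Submodule.exists_le_ker_of_notMem hx
    have hgv : ∀ i, g (v i) = 0 := fun i => hg' (Submodule.subset_span ⟨i, rfl⟩)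
    have hfx : ((g x)⁻¹ • g) x = 1 := by simp [hg]
    have hfv : ∀ i, ((g x)⁻¹ • g) (v i) = 0 := fun i => by simp [hgv]
    have e1 := wedge_aux φ v x _ hfx hfv
    have e2 := wedge_aux ψ v x _ hfx hfv
    rw [h, e2] at e1
    have hc : ((Finset.univ.filter (fun σ : Equiv.Perm (Fin (k+1)) =>
        σ (Fin.last k) = Fin.last k)).card : ℝ) ≠ 0 := by
      rw [Nat.cast_ne_zero]
      exact Finset.card_ne_zero_of_mem (a := 1) (by simp)
    have hf : ((k.factorial : ℝ))⁻¹ ≠ 0 := by positivity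
    exact (mul_left_cancel₀ hc (mul_left_cancel₀ hf e1)).symm
  · rw [φ.map_linearDependent v hv, ψ.map_linearDependent v hv]

end
end

section
/- For 1 ≤ k ≤ m, the operator P := j ∘ c̄ : Λ^k V* ⊗ V → Λ^k V* ⊗ V is a projection, i.e. P ∘ P = P. -/
open scoped TensorProduct

noncomputable section

variable {V : Type} [AddCommGroup V] [Module ℝ V]

/-- The normalized contraction `c̄ = ((-1)^{k-1}/(m-k+1)) c` on `Λ^{k+1} V* ⊗ V`
(the degree is written as `k+1`). -/
def cbar (m k : ℕ) (K : AlternatingMap ℝ V V (Fin (k + 1))) : AlternatingMap ℝ V ℝ (Fin k) :=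
  ((-1 : ℝ) ^ k / ((m : ℝ) - (k : ℝ))) • contr K

/-- The operator `P = j ∘ c̄`. -/
def Pproj (m k : ℕ) (K : AlternatingMap ℝ V V (Fin (k + 1))) : AlternatingMap ℝ V V (Fin (k + 1)) :=
  wedgeI (cbar m k K)

theorem wedgeI_apply_aux {k : ℕ} (φ : AlternatingMap ℝ V ℝ (Fin k)) (v : Fin (k + 1) → V) :
    wedgeI φ v = ((-1 : ℝ) ^ k) • ∑ p : Fin (k + 1), (if p = 0 then (1 : ℝ) else -1) •
      (φ (fun i => v (Equiv.swap 0 p i.succ)) • v p) := by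
  have h1 : wedgeI φ v = ((k.factorial : ℝ))⁻¹ • ∑ σ : Equiv.Perm (Fin (k + 1)),
      ((Equiv.Perm.sign σ : ℤ) : ℝ) •
        (φ (fun i => v (σ (Fin.castSucc i))) • v (σ (Fin.last k))) := by
    simp only [wedgeI, AlternatingMap.smul_apply, MultilinearMap.alternatization_apply]
    congr 1
    refine Finset.sum_congr rfl fun σ _ => ?_
    rw [Units.smul_def, Int.cast_smul_eq_zsmul]
    congr 1
  have h2 : ∀ (p : Fin (k + 1)) (τ : Equiv.Perm (Fin k)),
      (Equiv.Perm.decomposeFin.symm (p, τ) * finRotate (k + 1)) (Fin.last k) = p := by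
    intro p τ
    simp [Equiv.Perm.mul_apply, finRotate_last]
  have h3 : ∀ (p : Fin (k + 1)) (τ : Equiv.Perm (Fin k)) (i : Fin k),
      (Equiv.Perm.decomposeFin.symm (p, τ) * finRotate (k + 1)) (Fin.castSucc i)
        = Equiv.swap 0 p (τ i).succ := by
    intro p τ i
    have : finRotate (k + 1) (Fin.castSucc i) = i.succ := by
      rw [finRotate_succ_apply]; simp
    rw [Equiv.Perm.mul_apply, this]
    simp
  have hk : (k.factorial : ℝ) ≠ 0 := by exact_mod_cast k.factorial_ne_zero
  rw [h1, inv_smul_eq_iff₀ hk,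
    ← Equiv.sum_comp (Equiv.mulRight (finRotate (k + 1))),
    ← Equiv.sum_comp Equiv.Perm.decomposeFin.symm, Fintype.sum_prod_type,
    Finset.smul_sum, Finset.smul_sum]
  refine Finset.sum_congr rfl fun p _ => ?_
  have h4 : ∀ τ : Equiv.Perm (Fin k),
      φ (fun i => v (Equiv.swap 0 p (τ i).succ)) =
        ((Equiv.Perm.sign τ : ℤ) : ℝ) * φ (fun i => v (Equiv.swap 0 p i.succ)) := by
    intro τ
    have := φ.map_perm (fun i => v (Equiv.swap 0 p i.succ)) τ
    rw [Units.smul_def, ← Int.cast_smul_eq_zsmul ℝ, smul_eq_mul] at this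
    exact this
  have h5 : ∀ τ : Equiv.Perm (Fin k),
      ((Equiv.Perm.sign τ : ℤ) : ℝ) * ((Equiv.Perm.sign τ : ℤ) : ℝ) = 1 := by
    intro τ
    rcases Int.units_eq_one_or (Equiv.Perm.sign τ) with h | h <;> simp [h]
  have h6 : ∀ τ : Equiv.Perm (Fin k),
      ((Equiv.Perm.sign (Equiv.Perm.decomposeFin.symm (p, τ) * finRotate (k + 1)) : ℤ) : ℝ)
        = (if p = 0 then (1 : ℝ) else -1) * ((Equiv.Perm.sign τ : ℤ) : ℝ) * (-1) ^ k := by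
    intro τ
    rw [Equiv.Perm.sign_mul, Equiv.Perm.decomposeFin.symm_sign, sign_finRotate]
    split_ifs <;> simp
  have h7 : ∀ τ : Equiv.Perm (Fin k),
      ((Equiv.Perm.sign (Equiv.mulRight (finRotate (k + 1))
          (Equiv.Perm.decomposeFin.symm (p, τ))) : ℤ) : ℝ) •
        (φ (fun i => v ((Equiv.mulRight (finRotate (k + 1))
          (Equiv.Perm.decomposeFin.symm (p, τ))) (Fin.castSucc i))) •
          v ((Equiv.mulRight (finRotate (k + 1))
          (Equiv.Perm.decomposeFin.symm (p, τ))) (Fin.last k)))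
      = (-1 : ℝ) ^ k • ((if p = 0 then (1 : ℝ) else -1) •
      (φ (fun i => v (Equiv.swap 0 p i.succ)) • v p)) := by
    intro τ
    simp only [Equiv.coe_mulRight, h2, h3, h4, h6, smul_smul]
    congr 1
    linear_combination ((if p = 0 then (1 : ℝ) else -1) * (-1) ^ k *
      φ (fun i => v (Equiv.swap 0 p i.succ))) * h5 τ
  rw [Finset.sum_congr rfl fun τ _ => h7 τ, Finset.sum_const, Finset.card_univ,
    Fintype.card_perm, Fintype.card_fin, ← Nat.cast_smul_eq_nsmul ℝ]

theorem contr_wedgeI_aux [FiniteDimensional ℝ V] {k : ℕ} (φ : AlternatingMap ℝ V ℝ (Fin k)) :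
    contr (wedgeI φ) = ((-1 : ℝ) ^ k * ((Module.finrank ℝ V : ℝ) - k)) • φ := by
  ext w
  have h : curryFst (wedgeI φ) w = ((-1 : ℝ) ^ k) • (φ w • LinearMap.id -
      ∑ j : Fin k, (φ.toMultilinearMap.toLinearMap w j).smulRight (w j)) := by
    ext x
    change wedgeI φ (Fin.cons x w) = _
    rw [wedgeI_apply_aux, Fin.sum_univ_succ]
    have h2 : ∀ j : Fin k, (fun i : Fin k => (Fin.cons x w : Fin (k + 1) → V)
        (Equiv.swap 0 j.succ i.succ)) = Function.update w j x := by
      intro j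
      funext i
      by_cases hij : i = j
      · subst hij; simp
      · rw [Equiv.swap_apply_of_ne_of_ne (Fin.succ_ne_zero i) (by simpa using hij)]
        simp [hij]
    simp [h2, Fin.succ_ne_zero, sub_eq_add_neg]
  change LinearMap.trace ℝ V (curryFst (wedgeI φ) w) = _
  rw [h]
  simp [LinearMap.trace_smulRight]
  ring

theorem wedgeI_smul_aux {k : ℕ} (a : ℝ) (φ : AlternatingMap ℝ V ℝ (Fin k)) :
    wedgeI (a • φ) = a • wedgeI φ := by
  ext v
  simp only [wedgeI_apply_aux, AlternatingMap.smul_apply, Finset.smul_sum, smul_smul]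
  refine Finset.sum_congr rfl fun p _ => ?_
  congr 1
  simp only [smul_eq_mul]
  ring

/-- For `1 ≤ k ≤ m`, the operator `P = j ∘ c̄` on `Λ^k V* ⊗ V` is a projection,
`P ∘ P = P` (degree written as `k+1`). -/
theorem Pproj_idem [FiniteDimensional ℝ V] (m : ℕ) (hm : Module.finrank ℝ V = m)
    (k : ℕ) (hk : k + 1 ≤ m) (K : AlternatingMap ℝ V V (Fin (k + 1))) :
    Pproj m k (Pproj m k K) = Pproj m k K := by
  have h0 : (m : ℝ) - k ≠ 0 := by
    have : ((k + 1 : ℕ) : ℝ) ≤ m := by exact_mod_cast hk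
    push_cast at this
    linarith
  have h1 : ((-1 : ℝ) ^ k) * (-1) ^ k = 1 := by
    rw [← mul_pow]; simp
  have key : ∀ φ : AlternatingMap ℝ V ℝ (Fin k), cbar m k (wedgeI φ) = φ := by
    intro φ
    rw [cbar, contr_wedgeI_aux, hm, smul_smul]
    have : (-1 : ℝ) ^ k / ((m : ℝ) - k) * ((-1) ^ k * ((m : ℝ) - k)) = 1 := by
      field_simp
      rw [pow_two, h1]
    rw [this, one_smul]
  unfold Pproj
  rw [key]

end
end

section
/- Traceless V-valued forms are closed under the Nijenhuis–Richardson bracket: if K ∈ Λ^k V* ⊗ V and L ∈ Λ^ℓ V* ⊗ V (k, ℓ ≥ 1) satisfy c(K) = 0 and c(L) = 0, then c([K,L]^∧) = 0. -/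
open scoped TensorProduct

noncomputable section

variable {V : Type} [AddCommGroup V] [Module ℝ V]

/-- Evaluation `x ⊗ f ↦ f x`. -/
def evalT : (V ⊗[ℝ] (V →ₗ[ℝ] V)) →ₗ[ℝ] V :=
  TensorProduct.lift (LinearMap.id (M := V →ₗ[ℝ] V)).flip

/-- The Nijenhuis–Richardson insertion operator `i_K L`, given on decomposable elements by
`i_{φ⊗X}(ψ⊗Y) = (φ ∧ i_X ψ) ⊗ Y`; here realized as the factorial-normalized alternatization
of the composition `(v, w) ↦ L (K v, w)`. -/
def insertionNR {k l : ℕ} (K : AlternatingMap ℝ V V (Fin (k + 1)))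
    (L : AlternatingMap ℝ V V (Fin (l + 1))) : AlternatingMap ℝ V V (Fin (k + 1 + l)) :=
  (((k + 1).factorial * l.factorial : ℝ))⁻¹ •
    MultilinearMap.alternatization
      (MultilinearMap.domDomCongr finSumFinEquiv
        (evalT.compMultilinearMap
          (K.toMultilinearMap.domCoprod (curryFst L).toMultilinearMap)))

/-- The (algebraic) Nijenhuis–Richardson bracket
`[K,L]^∧ = i_K L - (-1)^{(k-1)(l-1)} i_L K` for `K` of degree `k+1` and `L` of degree `l+1`. -/
def bracketNR {k l : ℕ} (K : AlternatingMap ℝ V V (Fin (k + 1)))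
    (L : AlternatingMap ℝ V V (Fin (l + 1))) : AlternatingMap ℝ V V (Fin (k + l + 1)) :=
  (insertionNR K L).domDomCongr (finCongr (by omega)) -
    ((-1 : ℝ) ^ (k * l)) • (insertionNR L K).domDomCongr (finCongr (by omega))

/-- The wedge product of scalar alternating forms (determinant convention). -/
def wedgeForms {k l : ℕ} (φ : AlternatingMap ℝ V ℝ (Fin k)) (ψ : AlternatingMap ℝ V ℝ (Fin l)) :
    AlternatingMap ℝ V ℝ (Fin (k + l)) :=
  ((k.factorial * l.factorial : ℝ))⁻¹ •
    MultilinearMap.alternatization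
      (MultilinearMap.domDomCongr finSumFinEquiv
        ((LinearMap.mul' ℝ ℝ).compMultilinearMap
          (φ.toMultilinearMap.domCoprod ψ.toMultilinearMap)))


def blkA {k l n : ℕ} (h : k + l = n) (i : Fin k) : Fin n := ⟨i, by omega⟩

def blkB {k l n : ℕ} (h : k + l = n) (j : Fin l) : Fin n := ⟨k + j, by omega⟩

lemma blkB_succ {k l n : ℕ} (h : k + l = n) (j : Fin l) :
    blkB (k := k + 1) (n := n + 1) (by omega) j = (blkB h j).succ := by
  apply Fin.ext; simp [blkB]; omega

lemma blkA_succ {k l n : ℕ} (h : k + l = n) (h' : k + 1 + l = n + 1) (i : Fin k) :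
    blkA h' i.succ = (blkA h i).succ := by
  apply Fin.ext; simp [blkA]

lemma blkA_inj {k l n : ℕ} (h : k + l = n) : Function.Injective (blkA h) := by
  intro a b hab
  simpa [blkA, Fin.ext_iff] using hab

lemma blkB_inj {k l n : ℕ} (h : k + l = n) : Function.Injective (blkB h) := by
  intro a b hab
  simpa [blkB, Fin.ext_iff] using hab

lemma blkA_ne_blkB {k l n : ℕ} (h : k + l = n) (i : Fin k) (j : Fin l) : blkA h i ≠ blkB h j := by
  simp [blkA, blkB, Fin.ext_iff]; omega

lemma insertion_apply {k l n : ℕ} (h : k + 1 + l = n)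
    (K : AlternatingMap ℝ V V (Fin (k + 1))) (L : AlternatingMap ℝ V V (Fin (l + 1)))
    (v : Fin n → V) :
    (insertionNR K L).domDomCongr (finCongr h) v =
      (((k + 1).factorial * l.factorial : ℝ))⁻¹ •
        ∑ σ : Equiv.Perm (Fin n), Equiv.Perm.sign σ •
          L (Fin.cons (K (fun i => v (σ (blkA h i)))) (fun j => v (σ (blkB h j)))) := by
  subst h
  simp only [insertionNR, AlternatingMap.domDomCongr_apply, AlternatingMap.smul_apply,
    MultilinearMap.alternatization_apply]
  rfl

lemma contr_eq {ι : Type} [Fintype ι] [DecidableEq ι] (b : Module.Basis ι ℝ V) {n : ℕ}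
    (M : AlternatingMap ℝ V V (Fin (n + 1))) (w : Fin n → V) :
    contr M w = ∑ a, b.coord a (M (Fin.cons (b a) w)) := by
  show LinearMap.trace ℝ V (curryFst M w) = _
  rw [LinearMap.trace_eq_matrix_trace ℝ b, Matrix.trace]
  simp [LinearMap.toMatrix_apply, curryFst]

lemma sum_perm_succ {M : Type} [AddCommGroup M] {n : ℕ} (f : (Fin (n + 1) → Fin (n + 1)) → M) :
    ∑ σ : Equiv.Perm (Fin (n + 1)), Equiv.Perm.sign σ • f σ =
    ∑ p : Fin (n + 1), ∑ e : Equiv.Perm (Fin n), (Equiv.Perm.sign (Equiv.swap 0 p) *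
      Equiv.Perm.sign e) • f (fun i => (Fin.cons 0 (fun j => (e j).succ) : Fin (n + 1) → Fin (n + 1))
        (Equiv.swap 0 p i)) := by
  rw [← Fintype.sum_prod_type']
  rw [← Equiv.sum_comp (Equiv.inv (Equiv.Perm (Fin (n+1))))]
  rw [← Equiv.Perm.decomposeFin.symm.sum_comp]
  rw [← Equiv.sum_comp ((Equiv.refl (Fin (n+1))).prodCongr (Equiv.inv (Equiv.Perm (Fin n))))]
  refine Finset.sum_congr rfl fun x _ => ?_
  obtain ⟨p, e⟩ := x
  simp only [Equiv.prodCongr_apply, Prod.map, Equiv.refl_apply, Equiv.inv_apply,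
    Equiv.Perm.sign_inv, Equiv.Perm.decomposeFin.symm_sign, Equiv.Perm.sign_swap']
  simp only [eq_comm (a := (0 : Fin (n+1)))]
  congr 2
  funext i
  rw [Equiv.Perm.inv_eq_iff_eq]
  rcases Fin.eq_zero_or_eq_succ (Equiv.swap 0 p i) with h | ⟨j, h⟩
  · rw [h, Fin.cons_zero, Equiv.Perm.decomposeFin_symm_apply_zero]
    rw [Equiv.swap_apply_eq_iff] at h
    simpa using h
  · rw [h, Fin.cons_succ, Equiv.Perm.decomposeFin_symm_apply_succ]
    rw [Equiv.swap_apply_eq_iff] at h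
    simpa using h

lemma caseA {k l n : ℕ} (h : k + l = n) (h' : k + 1 + l = n + 1)
    (K : AlternatingMap ℝ V V (Fin (k + 1))) (L : AlternatingMap ℝ V V (Fin (l + 1)))
    (u : Fin (n + 1) → V) (i : Fin (k + 1)) :
    Equiv.Perm.sign (Equiv.swap 0 (blkA h' i)) •
      L (Fin.cons (K (fun a => u (Equiv.swap 0 (blkA h' i) (blkA h' a))))
        (fun c => u (Equiv.swap 0 (blkA h' i) (blkB h' c)))) =
    L (Fin.cons (K (fun a => u (blkA h' a))) (fun c => u (blkB h' c))) := by
  have h0 : (0 : Fin (n + 1)) = blkA h' 0 := rfl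
  have e1 : (fun a => u (Equiv.swap 0 (blkA h' i) (blkA h' a))) =
      (fun a => u (blkA h' a)) ∘ Equiv.swap 0 i := by
    funext a
    rw [h0, (blkA_inj h').swap_apply]; rfl
  have e2 : (fun c => u (Equiv.swap 0 (blkA h' i) (blkB h' c))) = fun c => u (blkB h' c) := by
    funext c
    rw [Equiv.swap_apply_of_ne_of_ne]
    · exact (blkA_ne_blkB h' 0 c).symm
    · exact (blkA_ne_blkB h' i c).symm
  have e3 : Equiv.Perm.sign (Equiv.swap 0 (blkA h' i)) = Equiv.Perm.sign (Equiv.swap 0 i) := by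
    rw [Equiv.Perm.sign_swap', Equiv.Perm.sign_swap', h0]
    simp only [(blkA_inj h').eq_iff]
  rw [e1, e2, e3, AlternatingMap.map_perm]
  rw [Equiv.Perm.sign_swap']
  have hneg : ∀ (x : V) w, L (Fin.cons (-x) w) = - L (Fin.cons x w) :=
    fun x w => (curryFst L w).map_neg x
  split_ifs <;> simp [hneg]

lemma caseB {ι : Type} [Fintype ι] [DecidableEq ι] (b : Module.Basis ι ℝ V)
    {k l n : ℕ} (h : k + l = n) (h' : k + 1 + l = n + 1)
    (K : AlternatingMap ℝ V V (Fin (k + 1))) (L : AlternatingMap ℝ V V (Fin (l + 1)))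
    (hL : contr L = 0)
    (u : Fin n → V) (j : Fin l) :
    ∑ x, b.coord x
      (L (Fin.cons (K (fun a => (Fin.cons (b x) u : Fin (n+1) → V)
          (Equiv.swap 0 (blkB h' j) (blkA h' a))))
        (fun c => (Fin.cons (b x) u : Fin (n+1) → V)
          (Equiv.swap 0 (blkB h' j) (blkB h' c))))) = 0 := by
  have h0 : (0 : Fin (n + 1)) = blkA h' 0 := rfl
  set A : Fin (k+1) → V := Fin.cons (u (blkB h j)) (fun i => u (blkA h i)) with hA
  have e1 : ∀ x, (fun a => (Fin.cons (b x) u : Fin (n+1) → V)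
          (Equiv.swap 0 (blkB h' j) (blkA h' a))) = A := by
    intro x
    funext a
    refine Fin.cases ?_ (fun i => ?_) a
    · rw [← h0, Equiv.swap_apply_left, blkB_succ h, Fin.cons_succ]; rfl
    · rw [Equiv.swap_apply_of_ne_of_ne, blkA_succ h, Fin.cons_succ]
      · rfl
      · rw [blkA_succ h]; exact Fin.succ_ne_zero _
      · exact blkA_ne_blkB h' _ _
  have e2 : ∀ x, (Fin.cons (K A) (fun c => (Fin.cons (b x) u : Fin (n+1) → V)
          (Equiv.swap 0 (blkB h' j) (blkB h' c))) : Fin (l+1) → V) =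
      (Fin.cons (b x) (Function.update (fun c => u (blkB h c)) j (K A)) : Fin (l+1) → V)
        ∘ Equiv.swap 0 j.succ := by
    intro x
    funext c
    refine Fin.cases ?_ (fun c => ?_) c
    · simp
    · by_cases hc : c = j
      · subst hc
        rw [Function.comp, Equiv.swap_apply_right, Fin.cons_succ, Equiv.swap_apply_right]; rfl
      · rw [Function.comp, Equiv.swap_apply_of_ne_of_ne, Fin.cons_succ, Fin.cons_succ,
          Equiv.swap_apply_of_ne_of_ne, Function.update_of_ne hc, blkB_succ h, Fin.cons_succ]
        · rw [blkB_succ h]; exact Fin.succ_ne_zero _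
        · exact fun hh => hc (blkB_inj h' hh)
        · exact Fin.succ_ne_zero _
        · simpa using hc
  simp only [e1, e2]
  have := contr_eq b L (Function.update (fun c => u (blkB h c)) j (K A))
  rw [hL] at this
  simp only [L.map_swap _ (Fin.succ_ne_zero j).symm, map_neg, Finset.sum_neg_distrib, ← this]
  simp

lemma contr_ins {k l n : ℕ} [FiniteDimensional ℝ V] (h : k + l = n) (h' : k + 1 + l = n + 1)
    (K : AlternatingMap ℝ V V (Fin (k + 1))) (L : AlternatingMap ℝ V V (Fin (l + 1)))
    (hL : contr L = 0) (w : Fin n → V) :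
    contr ((insertionNR K L).domDomCongr (finCongr h')) w =
      ((k.factorial * l.factorial : ℝ))⁻¹ *
        ∑ e : Equiv.Perm (Fin n), Equiv.Perm.sign e •
          LinearMap.trace ℝ V (curryFst L (fun j => w (e (blkB h j))) *
            curryFst K (fun i => w (e (blkA h i)))) := by
  classical
  let b := Module.finBasis ℝ V
  have hc : ∀ (x : V) (e : Equiv.Perm (Fin n)) (i : Fin (n+1)),
      (Fin.cons x w : Fin (n+1) → V) ((Fin.cons 0 (fun j => (e j).succ) : Fin (n+1) → Fin (n+1)) i)
        = (Fin.cons x (fun j => w (e j)) : Fin (n+1) → V) i := by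
    intro x e i
    refine Fin.cases ?_ (fun i => ?_) i <;> simp
  have step : ∀ x : V, (insertionNR K L).domDomCongr (finCongr h') (Fin.cons x w) =
      (((k + 1).factorial * l.factorial : ℝ))⁻¹ •
        ∑ p : Fin (n + 1), ∑ e : Equiv.Perm (Fin n), (Equiv.Perm.sign (Equiv.swap 0 p) *
      Equiv.Perm.sign e) • L (Fin.cons (K (fun a => (Fin.cons x (fun j => w (e j)) : Fin (n+1) → V)
          (Equiv.swap 0 p (blkA h' a))))
        (fun c => (Fin.cons x (fun j => w (e j)) : Fin (n+1) → V)
          (Equiv.swap 0 p (blkB h' c)))) := by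
    intro x
    rw [insertion_apply h']
    congr 1
    rw [sum_perm_succ (fun σ => L (Fin.cons (K (fun i => (Fin.cons x w : Fin (n+1) → V)
      (σ (blkA h' i)))) (fun j => (Fin.cons x w : Fin (n+1) → V) (σ (blkB h' j)))))]
    simp only [hc]
  have hsp : ∀ f : Fin (n+1) → ℝ, ∑ p, f p = ∑ i, f (blkA h' i) + ∑ j, f (blkB h' j) := by
    intro f
    rw [← (finSumFinEquiv.trans (finCongr h')).sum_comp, Fintype.sum_sum_type]
    rfl
  have hu : ∀ (s : ℤˣ) (a) (x : V), b.coord a (s • x) = s • b.coord a x := by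
    intro s a x
    rcases Int.units_eq_one_or s with rfl | rfl <;> simp
  rw [contr_eq b]
  simp only [step, map_smul, map_sum, hu]
  rw [← Finset.smul_sum, Finset.sum_comm, hsp]
  have hB : ∀ j, (∑ x, ∑ e : Equiv.Perm (Fin n), (Equiv.Perm.sign (Equiv.swap 0 (blkB h' j)) *
      Equiv.Perm.sign e) • b.coord x (L (Fin.cons (K (fun a => (Fin.cons (b x) (fun j => w (e j)) : Fin (n+1) → V)
          (Equiv.swap 0 (blkB h' j) (blkA h' a))))
        (fun c => (Fin.cons (b x) (fun j => w (e j)) : Fin (n+1) → V)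
          (Equiv.swap 0 (blkB h' j) (blkB h' c)))))) = 0 := by
    intro j
    rw [Finset.sum_comm]
    refine Finset.sum_eq_zero fun e _ => ?_
    rw [← Finset.smul_sum, caseB b h h' K L hL, smul_zero]
  have hA : ∀ i, (∑ x, ∑ e : Equiv.Perm (Fin n), (Equiv.Perm.sign (Equiv.swap 0 (blkA h' i)) *
      Equiv.Perm.sign e) • b.coord x (L (Fin.cons (K (fun a => (Fin.cons (b x) (fun j => w (e j)) : Fin (n+1) → V)
          (Equiv.swap 0 (blkA h' i) (blkA h' a))))
        (fun c => (Fin.cons (b x) (fun j => w (e j)) : Fin (n+1) → V)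
          (Equiv.swap 0 (blkA h' i) (blkB h' c)))))) = 
        ∑ e : Equiv.Perm (Fin n), Equiv.Perm.sign e •
          LinearMap.trace ℝ V (curryFst L (fun j => w (e (blkB h j))) *
            curryFst K (fun i => w (e (blkA h i)))) := by
    intro i
    rw [Finset.sum_comm]
    refine Finset.sum_congr rfl fun e _ => ?_
    rw [← Finset.smul_sum, mul_comm, mul_smul]
    congr 1
    rw [LinearMap.trace_eq_matrix_trace ℝ b, Matrix.trace, Finset.smul_sum]
    refine Finset.sum_congr rfl fun x _ => ?_
    rw [← hu, caseA h]
    simp only [Matrix.diag_apply, LinearMap.toMatrix_apply, Module.Basis.coord_apply]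
    congr 2
    show _ = L (Fin.cons (K (Fin.cons (b x) _)) _)
    congr 2
    · congr 1
      funext a
      refine Fin.cases rfl (fun a => ?_) a
      rw [blkA_succ h]; rfl
    · funext c
      rw [blkB_succ h]; rfl
  simp only [hA, hB]
  simp only [Finset.sum_const_zero, add_zero, Finset.sum_const, Finset.card_univ, Fintype.card_fin,
    nsmul_eq_mul, smul_eq_mul, Nat.factorial_succ]
  rw [← mul_assoc]
  congr 1
  have := Nat.cast_add_one_ne_zero (R := ℝ) k
  have := Nat.factorial_ne_zero k
  have := Nat.factorial_ne_zero l
  push_cast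
  field_simp

lemma rot_pow (n l : ℕ) (i : Fin n) : (((finRotate n) ^ l) i : ℕ) = (i + l) % n := by
  induction l with
  | zero => simp [Nat.mod_eq_of_lt]
  | succ l ih =>
    rw [pow_succ', Equiv.Perm.mul_apply]
    cases n with
    | zero => exact i.elim0
    | succ n =>
      rw [finRotate_apply, Fin.val_add, ih]
      rw [← add_assoc, Nat.add_mod (_ + l) 1, Fin.val_one', Nat.add_mod, Nat.mod_mod, Nat.mod_mod]

lemma sum_flip {k l : ℕ} (F : (Fin k → Fin (k + l)) → (Fin l → Fin (k + l)) → ℝ) :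
    ∑ e : Equiv.Perm (Fin (k + l)), Equiv.Perm.sign e •
      F (fun i => e (blkA rfl i)) (fun j => e (blkB rfl j)) =
    (-1) ^ (k * l) * ∑ e : Equiv.Perm (Fin (k + l)), Equiv.Perm.sign e •
      F (fun i => e (blkB (add_comm l k) i)) (fun j => e (blkA (add_comm l k) j)) := by
  rw [← Equiv.sum_comp (Equiv.mulRight ((finRotate (k + l)) ^ l)), Finset.mul_sum]
  refine Finset.sum_congr rfl fun e _ => ?_
  have hA : ∀ i : Fin k, ((finRotate (k + l)) ^ l) (blkA rfl i) = blkB (add_comm l k) i := by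
    intro i
    apply Fin.ext
    rw [rot_pow]
    simp only [blkA, blkB]
    rw [Nat.mod_eq_of_lt (by omega)]; omega
  have hB : ∀ j : Fin l, ((finRotate (k + l)) ^ l) (blkB rfl j) = blkA (add_comm l k) j := by
    intro i
    apply Fin.ext
    rw [rot_pow]
    simp only [blkA, blkB]
    rw [show k + (i : ℕ) + l = i + (k + l) by omega, Nat.add_mod_right,
      Nat.mod_eq_of_lt (by omega)]
  have hs : Equiv.Perm.sign ((finRotate (k + l)) ^ l) = (-1) ^ (k * l) := by
    rw [map_pow, sign_finRotate, ← pow_mul]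
    rcases l with _ | l
    · simp
    · have : (k + (l + 1) - 1) * (l + 1) = k * (l + 1) + l * (l + 1) := by
        rw [← add_assoc, Nat.add_sub_cancel]; ring
      rw [this, pow_add, (Nat.even_mul_succ_self l).neg_one_pow, mul_one]
  simp only [Equiv.coe_mulRight, Equiv.Perm.mul_apply, hA, hB, Equiv.Perm.sign_mul, hs]
  rw [mul_comm, mul_smul, Units.smul_def]
  simp

/-- Traceless vector valued forms are closed under the Nijenhuis–Richardson
bracket: if `c K = 0` and `c L = 0` then `c [K,L]^∧ = 0` (degrees written `k+1`, `l+1 ≥ 1`). -/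
theorem contr_bracketNR [FiniteDimensional ℝ V] (k l : ℕ)
    (K : AlternatingMap ℝ V V (Fin (k + 1))) (L : AlternatingMap ℝ V V (Fin (l + 1)))
    (hK : contr K = 0) (hL : contr L = 0) :
    contr (bracketNR K L) = 0 := by
  ext w
  have e : contr (bracketNR K L) w =
      contr ((insertionNR K L).domDomCongr (finCongr (by omega : k + 1 + l = k + l + 1))) w -
      (-1 : ℝ) ^ (k * l) *
        contr ((insertionNR L K).domDomCongr (finCongr (by omega : l + 1 + k = k + l + 1))) w := by
    have := (contrL (V := V) (k + l)).map_sub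
      ((insertionNR K L).domDomCongr (finCongr (by omega : k + 1 + l = k + l + 1)))
      (((-1 : ℝ) ^ (k * l)) •
        (insertionNR L K).domDomCongr (finCongr (by omega : l + 1 + k = k + l + 1)))
    rw [map_smul] at this
    exact congrArg (fun f => f w) this
  rw [e, contr_ins rfl _ K L hL, contr_ins (add_comm l k) _ L K hK]
  rw [sum_flip (fun x y => LinearMap.trace ℝ V (curryFst L (fun j => w (y j)) *
            curryFst K (fun i => w (x i))))]
  simp only [LinearMap.trace_mul_comm ℝ (curryFst L _)]
  simp only [AlternatingMap.zero_apply]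
  ring

end
end

section
/- On the exterior algebra ⋀ W of a real vector space W, the bracket defined on homogeneous elements φ of degree k and ψ of degree ℓ by [φ, ψ]^∧ := (ℓ − k) φ ∧ ψ makes ⋀ W a ℤ-graded Lie algebra: it satisfies the graded antisymmetry [φ,ψ]^∧ = −(−1)^{kℓ} [ψ,φ]^∧ and the graded Jacobi identity (−1)^{kn}[φ,[ψ,χ]^∧]^∧ + (−1)^{ℓk}[ψ,[χ,φ]^∧]^∧ + (−1)^{nℓ}[χ,[φ,ψ]^∧]^∧ = 0 for homogeneous φ, ψ, χ of degrees k, ℓ, n. -/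
theorem aux_iota_comm (W : Type*) [AddCommGroup W] [Module ℝ W] (m : W)
    (l : ℕ) (ψ : ExteriorAlgebra ℝ W) (hψ : ψ ∈ ⋀[ℝ]^l W) :
    ψ * ExteriorAlgebra.ι ℝ m = ((-1 : ℝ) ^ l) • (ExteriorAlgebra.ι ℝ m * ψ) := by
  change ψ ∈ (LinearMap.range (ExteriorAlgebra.ι ℝ : W →ₗ[ℝ] _)) ^ l at hψ
  induction hψ using Submodule.pow_induction_on_left' with
  | algebraMap r => simp [Algebra.commutes]
  | add x y i hx hy h1 h2 => rw [add_mul, h1, h2, mul_add, smul_add]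
  | mem_mul x hx i y hy ih =>
    obtain ⟨w, rfl⟩ := hx
    have h : ExteriorAlgebra.ι ℝ w * ExteriorAlgebra.ι ℝ m =
        -(ExteriorAlgebra.ι ℝ m * ExteriorAlgebra.ι ℝ w) :=
      eq_neg_of_add_eq_zero_left (ExteriorAlgebra.ι_add_mul_swap w m)
    rw [mul_assoc, ih, mul_smul_comm, ← mul_assoc, h, pow_succ, ← mul_assoc]
    simp

theorem aux_comm (W : Type*) [AddCommGroup W] [Module ℝ W]
    (k l : ℕ) (φ ψ : ExteriorAlgebra ℝ W) (hφ : φ ∈ ⋀[ℝ]^k W) (hψ : ψ ∈ ⋀[ℝ]^l W) :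
    ψ * φ = ((-1 : ℝ) ^ (k * l)) • (φ * ψ) := by
  change φ ∈ (LinearMap.range (ExteriorAlgebra.ι ℝ : W →ₗ[ℝ] _)) ^ k at hφ
  induction hφ using Submodule.pow_induction_on_left' with
  | algebraMap r => simp [Algebra.commutes]
  | add x y i hx hy h1 h2 => rw [add_mul, mul_add, h1, h2, smul_add]
  | mem_mul x hx i y hy ih =>
    obtain ⟨w, rfl⟩ := hx
    rw [← mul_assoc, aux_iota_comm W w l ψ hψ, smul_mul_assoc, mul_assoc, ih, mul_smul_comm,
      smul_smul, mul_assoc]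
    congr 1
    rw [Nat.succ_mul, pow_add, mul_comm]

theorem aux_sq (a : ℕ) : ((-1 : ℝ) ^ a) * ((-1 : ℝ) ^ a) = 1 := by
  rw [← mul_pow]; simp


/-- On the exterior algebra `⋀ W` of a real vector space `W`, the bracket defined
on homogeneous elements `φ` of degree `k` and `ψ` of degree `l` by `[φ,ψ]^∧ := (l - k) φ ∧ ψ`
makes `⋀ W` a ℤ-graded Lie algebra: the bracket of elements of degrees `k` and `l` is
homogeneous of degree `k + l`, it satisfies graded antisymmetry
`[φ,ψ]^∧ = -(-1)^{kl} [ψ,φ]^∧`, and the graded Jacobi identity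
`(-1)^{kn}[φ,[ψ,χ]^∧]^∧ + (-1)^{lk}[ψ,[χ,φ]^∧]^∧ + (-1)^{nl}[χ,[φ,ψ]^∧]^∧ = 0`
for homogeneous `φ, ψ, χ` of degrees `k, l, n`. -/
theorem exteriorAlgebra_bracket_gradedLie (W : Type*) [AddCommGroup W] [Module ℝ W]
    (k l n : ℕ) (φ ψ χ : ExteriorAlgebra ℝ W)
    (hφ : φ ∈ ⋀[ℝ]^k W) (hψ : ψ ∈ ⋀[ℝ]^l W) (hχ : χ ∈ ⋀[ℝ]^n W) :
    (((l : ℝ) - (k : ℝ)) • (φ * ψ) ∈ ⋀[ℝ]^(k + l) W) ∧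
    (((l : ℝ) - (k : ℝ)) • (φ * ψ) =
      -(((-1 : ℝ) ^ (k * l)) • (((k : ℝ) - (l : ℝ)) • (ψ * φ)))) ∧
    (((-1 : ℝ) ^ (k * n)) •
        ((((l : ℝ) + (n : ℝ)) - (k : ℝ)) • (φ * (((n : ℝ) - (l : ℝ)) • (ψ * χ)))) +
      ((-1 : ℝ) ^ (l * k)) •
        ((((n : ℝ) + (k : ℝ)) - (l : ℝ)) • (ψ * (((k : ℝ) - (n : ℝ)) • (χ * φ)))) +
      ((-1 : ℝ) ^ (n * l)) •
        ((((k : ℝ) + (l : ℝ)) - (n : ℝ)) • (χ * (((l : ℝ) - (k : ℝ)) • (φ * ψ)))) = 0) := by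
  have hm : φ * ψ ∈ ⋀[ℝ]^(k + l) W := by
    have := Submodule.mul_mem_mul hφ hψ
    rwa [← pow_add] at this
  have hm2 : ψ * χ ∈ ⋀[ℝ]^(l + n) W := by
    have := Submodule.mul_mem_mul hψ hχ
    rwa [← pow_add] at this
  refine ⟨Submodule.smul_mem _ _ hm, ?_, ?_⟩
  · rw [aux_comm W k l φ ψ hφ hψ, smul_smul, smul_smul, ← neg_smul]
    congr 1
    linear_combination ((k : ℝ) - l) * aux_sq (k * l)
  · have e1 := aux_comm W k (l + n) φ (ψ * χ) hφ hm2
    have e2 := aux_comm W (k + l) n (φ * ψ) χ hm hχ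
    rw [mul_assoc] at e1
    rw [mul_assoc] at e2
    simp only [mul_smul_comm, e1, e2, smul_smul, ← add_smul]
    convert zero_smul ℝ _ using 2
    have a1 := aux_sq (k * l)
    have a2 := aux_sq (l * n)
    rw [mul_add, add_mul, pow_add, pow_add, mul_comm l k, mul_comm n l]
    linear_combination (-1 : ℝ) ^ (k * n) * ((n : ℝ) + k - l) * (k - n) * a1 +
      (-1 : ℝ) ^ (k * n) * ((k : ℝ) + l - n) * (l - k) * a2
end
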